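/- Let q ≡ 1 (mod 4) be a prime power and let a be an odd positive integer with q ≡ 1 (mod a). For the Steinberg character St of SL₂(𝔽_q) (the irreducible character of degree q with St(diag(x,x^q)) = −1 for x ≠ x^q, St(±unipotent) = 0, St(diag(t,t⁻¹)) = 1 for t ≠ ±1, St(±Id) = q), the a-th Frobenius–Schur indicator ν_a(St) = (1/|SL₂(𝔽_q)|) Σ_{g} St(g^a) equals a − 1. -/

import Mathlib

set_option linter.unusedSectionVars false

section helpers
open Matrix

variable {F : Type} [Field F] [Fintype F] [DecidableEq F]

/-- number of (y,z) with y z = c, as sum of indicators -/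
lemma sum_yz (c : F) : (∑ y : F, ∑ z : F, (if c = y * z then (1:ℂ) else 0))
    = (Fintype.card F : ℂ) - 1 + (Fintype.card F : ℂ) * (if c = 0 then 1 else 0) := by
  have h : ∀ y : F, (∑ z : F, (if c = y * z then (1:ℂ) else 0))
      = if y = 0 then (Fintype.card F : ℂ) * (if c = 0 then 1 else 0) else 1 := by
    intro y
    by_cases hy : y = 0
    · subst hy; by_cases hc : c = 0 <;> simp [hc]
    · have : ∀ z : F, (c = y * z) ↔ (z = c / y) := by
        intro z; rw [eq_div_iff hy, eq_comm, mul_comm]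
      simp [this, hy]
  simp only [h]
  rw [← Finset.sum_erase_add _ _ (Finset.mem_univ (0:F))]
  rw [Finset.sum_congr rfl (g := fun _ => (1:ℂ))]
  · simp [Finset.card_erase_of_mem, Nat.cast_sub Fintype.card_pos]
  · intro x hx; simp at hx; simp [hx]

/-- parametrization of SL2 -/
def slEquiv : SpecialLinearGroup (Fin 2) F ≃ {p : F × F × F × F // p.2.1 * (p.1 - p.2.1) - 1 = p.2.2.1 * p.2.2.2} where
  toFun g := ⟨(g.val.trace, g.val 0 0, g.val 0 1, g.val 1 0), by
    have := g.2
    rw [Matrix.det_fin_two] at this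
    simp only [Matrix.trace_fin_two]
    linear_combination this⟩
  invFun p := ⟨!![p.1.2.1, p.1.2.2.1; p.1.2.2.2, p.1.1 - p.1.2.1], by
    have := p.2
    rw [Matrix.det_fin_two_of]
    linear_combination this⟩
  left_inv g := by
    ext i j
    fin_cases i <;> fin_cases j <;> simp [Matrix.trace_fin_two]
  right_inv p := by
    ext <;> simp [Matrix.trace_fin_two]

lemma sum_sl (f : F → ℂ) : ∑ g : SpecialLinearGroup (Fin 2) F, f g.val.trace
    = ∑ τ : F, f τ * ((Fintype.card F : ℂ) * ((Fintype.card F : ℂ) - 1) +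
      (Fintype.card F : ℂ) * ∑ x : F, if x * (τ - x) - 1 = 0 then 1 else 0) := by
  rw [← Equiv.sum_comp slEquiv.symm]
  have : ∀ p : {p : F × F × F × F // p.2.1 * (p.1 - p.2.1) - 1 = p.2.2.1 * p.2.2.2},
      f (slEquiv.symm p).val.trace = f p.1.1 := by
    intro p
    have h : (slEquiv (slEquiv.symm p)).1.1 = p.1.1 := by rw [Equiv.apply_symm_apply]
    exact congrArg f h
  simp only [this]
  rw [← Finset.sum_subtype (s := Finset.univ.filter (fun p : F × F × F × F => p.2.1 * (p.1 - p.2.1) - 1 = p.2.2.1 * p.2.2.2)) (by simp) (fun p => f p.1)]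
  rw [Finset.sum_filter, Fintype.sum_prod_type]
  refine Finset.sum_congr rfl fun τ _ => ?_
  rw [Fintype.sum_prod_type]
  have h1 : ∀ x : F, (∑ y : F × F, if x * (τ - x) - 1 = y.1 * y.2 then f τ else 0)
      = f τ * ((Fintype.card F : ℂ) - 1 + (Fintype.card F : ℂ) * (if x * (τ - x) - 1 = 0 then 1 else 0)) := by
    intro x
    rw [← sum_yz, Fintype.sum_prod_type]
    simp only [Finset.mul_sum, mul_ite, mul_one, mul_zero]
  simp only [h1]
  rw [← Finset.mul_sum, Finset.sum_add_distrib, ← Finset.mul_sum]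
  simp only [Finset.sum_const, Finset.card_univ, nsmul_eq_mul]

lemma card_sl : (Fintype.card (SpecialLinearGroup (Fin 2) F) : ℂ)
    = (Fintype.card F : ℂ) * ((Fintype.card F : ℂ)^2 - 1) := by
  have h := sum_sl (F := F) (fun _ => 1)
  have h2 : ∑ τ : F, ∑ x : F, (if x * (τ - x) - 1 = 0 then (1:ℂ) else 0) = (Fintype.card F : ℂ) - 1 := by
    rw [Finset.sum_comm]
    have : ∀ x : F, ∑ τ : F, (if x * (τ - x) - 1 = 0 then (1:ℂ) else 0) = if x = 0 then 0 else 1 := by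
      intro x
      by_cases hx : x = 0
      · simp [hx]
      · have : ∀ τ : F, x * (τ - x) - 1 = 0 ↔ τ = x + x⁻¹ := by
          intro τ
          constructor
          · intro h; field_simp; linear_combination h
          · rintro rfl; field_simp; ring
        simp [this, hx]
    simp only [this]
    rw [← Finset.sum_erase_add _ _ (Finset.mem_univ (0:F)), Finset.sum_congr rfl (g := fun _ => (1:ℂ))]
    · simp [Finset.card_erase_of_mem, Nat.cast_sub Fintype.card_pos]
    · intro x hx; simp at hx; simp [hx]
  simp only [one_mul, Finset.sum_add_distrib, ← Finset.mul_sum, h2] at h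
  simp at h
  rw [h]; ring

/-- trace recurrence -/
lemma cayley (g : SpecialLinearGroup (Fin 2) F) : g.val * g.val = g.val.trace • g.val - 1 := by
  have := g.2
  rw [Matrix.det_fin_two] at this
  ext i j
  fin_cases i <;> fin_cases j <;> simp [Matrix.mul_apply, Matrix.trace_fin_two] <;> first | (ring1) | linear_combination (1 : F) * this | linear_combination (-1 : F) * this

lemma trace_pow {K : Type*} [Field K] [Algebra F K] (g : SpecialLinearGroup (Fin 2) F) (t s : K) (hts : t * s = 1)
    (h : algebraMap F K g.val.trace = t + s) (n : ℕ) :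
    algebraMap F K (g.val ^ n).trace = t ^ n + s ^ n := by
  have key : ∀ n, algebraMap F K (g.val ^ n).trace = t ^ n + s ^ n ∧ algebraMap F K (g.val ^ (n+1)).trace = t ^ (n+1) + s ^ (n+1) := by
    intro n
    induction n with
    | zero =>
      have : (algebraMap F K) 2 = 2 := map_ofNat _ 2
      simp [h, this]; norm_num
    | succ n ih =>
      refine ⟨ih.2, ?_⟩
      have e : g.val ^ (n+1+1) = g.val.trace • g.val ^ (n+1) - g.val ^ n := by
        rw [pow_succ, pow_succ, mul_assoc, cayley]; simp [mul_sub]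
      rw [e, Matrix.trace_sub, Matrix.trace_smul, smul_eq_mul, map_sub, map_mul, ih.1, ih.2, h]
      linear_combination (t^n + s^n) * hts
  exact (key n).1

/-- diagonalizable power formula -/
lemma pow_formula (g : SpecialLinearGroup (Fin 2) F) (t s : F) (hts : t * s = 1)
    (h : g.val.trace = t + s) (n : ℕ) :
    (t - s) • g.val ^ n = t ^ n • (g.val - s • 1) - s ^ n • (g.val - t • 1) := by
  induction n with
  | zero => simp [sub_smul]
  | succ n ih =>
    rw [pow_succ, ← smul_mul_assoc, ih]
    have c := cayley g
    rw [h] at c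
    have e1 : (g.val - s • 1) * g.val = t • (g.val - s • 1) := by
      rw [sub_mul, c, smul_sub, smul_smul, hts]; simp [add_smul]; abel
    have e2 : (g.val - t • 1) * g.val = s • (g.val - t • 1) := by
      rw [sub_mul, c, smul_sub, smul_smul, mul_comm s t, hts]; simp [add_smul]; abel
    rw [sub_mul, smul_mul_assoc, smul_mul_assoc, e1, e2, smul_smul, smul_smul, pow_succ, pow_succ]

/-- unipotent power formula -/
lemma pow_formula' (g : SpecialLinearGroup (Fin 2) F) (t : F) (hts : t * t = 1)
    (h : g.val.trace = t + t) (n : ℕ) :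
    g.val ^ (n+1) = t ^ n • ((n+1 : F) • g.val - (n * t : F) • 1) := by
  induction n with
  | zero => simp
  | succ n ih =>
    rw [pow_succ, ih]
    have c := cayley g
    rw [h] at c
    rw [smul_mul_assoc, sub_mul, smul_mul_assoc, c]
    ext i j
    simp
    by_cases hij : i = j
    · subst hij
      simp
      linear_combination (t^n*(n+1)) * hts
    · simp [hij]; ring

lemma card_roots_unity (n : ℕ) (hn : 0 < n) (hd : n ∣ Fintype.card F - 1) :
    (Finset.univ.filter (fun t : F => t ^ n = 1)).card = n := by
  obtain ⟨ζ, hζ⟩ := IsCyclic.exists_generator (α := Fˣ)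
  have h1 : IsPrimitiveRoot ζ (Fintype.card F - 1) := by
    have := IsPrimitiveRoot.orderOf ζ
    rwa [orderOf_eq_card_of_forall_mem_zpowers hζ, Nat.card_eq_fintype_card, Fintype.card_units] at this
  have h2 := IsPrimitiveRoot.coe_units_iff.mpr h1
  obtain ⟨k, hk⟩ := hd
  have hpos : 0 < Fintype.card F - 1 := by
    have := Fintype.one_lt_card (α := F); omega
  have h3 := h2.pow hpos (hk.trans (mul_comm _ _))
  refine Eq.trans ?_ h3.card_nthRootsFinset
  congr 1
  ext t
  simp [Polynomial.mem_nthRootsFinset hn]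

/-- an element of an extension with `t ^ q = t` lies in the base field -/
lemma mem_base {K : Type*} [Field K] [Algebra F K] (t : K) (ht : t ^ (Fintype.card F) = t) :
    ∃ u : F, algebraMap F K u = t := by
  have hp : (∏ a : F, (Polynomial.X - Polynomial.C a)) = Polynomial.X ^ Fintype.card F - Polynomial.X := by
    have h1 := FiniteField.roots_X_pow_card_sub_X F
    have hdeg := FiniteField.X_pow_card_sub_X_natDegree_eq F (Fintype.one_lt_card (α := F))
    have hm : (Polynomial.X ^ Fintype.card F - Polynomial.X : Polynomial F).Monic :=
      Polynomial.monic_X_pow_sub (by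
        rw [Polynomial.degree_X]; exact_mod_cast Fintype.one_lt_card (α := F))
    have h3 := Polynomial.prod_multiset_X_sub_C_of_monic_of_roots_card_eq hm
      (by rw [h1, hdeg]; rfl)
    rw [h1] at h3
    exact h3
  have h2 := congrArg (Polynomial.aeval t) hp
  rw [map_prod] at h2
  simp [ht] at h2
  rw [Finset.prod_eq_zero_iff] at h2
  obtain ⟨u, -, hu⟩ := h2
  exact ⟨u, (sub_eq_zero.mp hu).symm⟩

lemma pm_one {R : Type*} [Field R] {t : R} (h : t ^ 2 = 1) : t = 1 ∨ t = -1 :=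
  by simpa using h

lemma nonsplit_pow (g : SpecialLinearGroup (Fin 2) F) (a : ℕ) (hq4 : Fintype.card F ≡ 1 [MOD 4])
    (hqa : Fintype.card F ≡ 1 [MOD a]) (u : F) (hu : u * ((g.val ^ a).trace - u) - 1 = 0) :
    ∃ t : F, t * (g.val.trace - t) - 1 = 0 := by
  set q := Fintype.card F with hq
  have hq1 : 1 < q := Fintype.one_lt_card
  let K := AlgebraicClosure F
  obtain ⟨t, ht⟩ : ∃ t : K, t * (algebraMap F K g.val.trace - t) = 1 := by
    have hdeg : (Polynomial.X ^ 2 - Polynomial.C (algebraMap F K g.val.trace) * Polynomial.X + 1 : Polynomial K).degree ≠ 0 := by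
      have : (Polynomial.X ^ 2 - Polynomial.C (algebraMap F K g.val.trace) * Polynomial.X + 1 : Polynomial K).degree = 2 := by
        compute_degree!
      rw [this]; decide
    obtain ⟨t, ht⟩ := IsAlgClosed.exists_root _ hdeg
    refine ⟨t, ?_⟩
    simp [Polynomial.IsRoot] at ht
    linear_combination -ht
  have hpow := trace_pow g t _ ht (by ring) a
  set s := algebraMap F K g.val.trace - t with hs
  have ht0 : t ≠ 0 := by rintro h; simp [h] at ht
  -- t^q is a root
  have frob : ∀ x y : K, (x + y) ^ q = x ^ q + y ^ q := by
    intro x y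
    have := map_add (FiniteField.frobeniusAlgHom F K) x y
    simpa using this
  have hbase : ∀ x : F, (algebraMap F K x) ^ q = algebraMap F K x := by
    intro x; rw [← map_pow, hq, FiniteField.pow_card]
  by_cases htq : t ^ q = t
  · obtain ⟨x, hx⟩ := mem_base t htq
    refine ⟨x, (algebraMap F K).injective ?_⟩
    rw [map_sub, map_mul, map_sub, hx, map_one, map_zero]
    linear_combination ht
  exfalso
  have h1 : t ^ q + s ^ q = t + s := by
    rw [← frob]
    have : t + s = algebraMap F K g.val.trace := by rw [hs]; ring
    rw [this, hbase]
  have h2 : t ^ q * s ^ q = 1 := by rw [← mul_pow, ht, one_pow]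
  have h3 : (t ^ q - t) * (t ^ q - s) = 0 := by
    linear_combination ht - h2 + t^q * h1
  have h4 : t ^ q = s := by
    rcases mul_eq_zero.mp h3 with h | h
    · exact absurd (sub_eq_zero.mp h) htq
    · exact sub_eq_zero.mp h
  have h5 : t ^ (q + 1) = 1 := by rw [pow_succ, h4, mul_comm, ht]
  -- t^a in F
  have hu' : algebraMap F K u * (t^a + s^a - algebraMap F K u) = 1 := by
    rw [← hpow, ← map_sub, ← map_mul, sub_eq_zero.mp hu, map_one]
  have hts : t^a * s^a = 1 := by rw [← mul_pow, ht, one_pow]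
  have h6 : (algebraMap F K u - t^a) * (algebraMap F K u - s^a) = 0 := by
    linear_combination hts - hu'
  have h7 : (t^a)^q = t^a := by
    rcases mul_eq_zero.mp h6 with h | h
    · rw [← sub_eq_zero.mp h, hbase]
    · have : s^a = algebraMap F K u := (sub_eq_zero.mp h).symm
      have h8 : (s^a)^q = s^a := by rw [this, hbase]
      have hsa : s^a ≠ 0 := right_ne_zero_of_mul_eq_one hts
      have : t^a = (s^a)⁻¹ := eq_inv_of_mul_eq_one_left hts
      rw [this, inv_pow, h8]
  have h9 : t ^ (2 * a) = 1 := by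
    have e : (t^a)^q * t^a = 1 := by
      rw [← pow_succ, ← pow_mul, mul_comm, pow_mul, h5, one_pow]
    rw [h7] at e
    rw [two_mul, pow_add, e]
  have ha1 : a ∣ q - 1 := (Nat.modEq_iff_dvd' hq1.le).mp hqa.symm
  have h41 : 4 ∣ q - 1 := (Nat.modEq_iff_dvd' hq1.le).mp hq4.symm
  have h10 : t ^ (2 * (q - 1)) = 1 := by
    obtain ⟨k, hk⟩ := ha1
    rw [hk, ← mul_assoc, pow_mul, h9, one_pow]
  have h11 : t ^ 4 = 1 := by
    have e : t ^ (2 * (q + 1)) = 1 := by rw [mul_comm, pow_mul, h5, one_pow]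
    have : 2 * (q + 1) = 2 * (q - 1) + 4 := by omega
    rw [this, pow_add, h10, one_mul] at e
    exact e
  apply htq
  obtain ⟨k, hk⟩ := h41
  have : q = 4 * k + 1 := by omega
  rw [this, pow_succ, pow_mul, h11, one_pow, one_mul]

/-- weight -/
noncomputable def wt (a : ℕ) (t : F) : ℂ :=
  1 + ((Fintype.card F : ℂ) - 1) / 2 * (if t ^ 2 ≠ 1 ∧ t ^ (2 * a) = 1 then 1 else 0)

lemma pointwise (a : ℕ) (haodd : Odd a) (hq4 : Fintype.card F ≡ 1 [MOD 4])
    (hqa : Fintype.card F ≡ 1 [MOD a])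
    (St : Matrix.SpecialLinearGroup (Fin 2) F → ℂ)
    (hcentral : ∀ g : Matrix.SpecialLinearGroup (Fin 2) F,
      g.val = 1 ∨ g.val = -1 → St g = Fintype.card F)
    (hunipotent : ∀ g : Matrix.SpecialLinearGroup (Fin 2) F,
      g.val ≠ 1 → g.val ≠ -1 → (g.val.trace = 2 ∨ g.val.trace = -2) → St g = 0)
    (hsplit : ∀ g : Matrix.SpecialLinearGroup (Fin 2) F,
      g.val.trace ≠ 2 → g.val.trace ≠ -2 →
      (∃ x : F, x ≠ 0 ∧ x ^ 2 = g.val.trace ^ 2 - 4) → St g = 1)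
    (hnonsplit : ∀ g : Matrix.SpecialLinearGroup (Fin 2) F,
      (¬ ∃ x : F, x ^ 2 = g.val.trace ^ 2 - 4) → St g = -1)
    (h2 : (2 : F) ≠ 0) (ha0 : (a : F) ≠ 0)
    (g : SpecialLinearGroup (Fin 2) F) :
    St (g ^ a) = (∑ t : F, if t * (g.val.trace - t) - 1 = 0 then wt a t else 0) - 1
      + (Fintype.card F : ℂ) * (if g.val = 1 ∨ g.val = -1 then 1 else 0) := by
  have hval : (g ^ a).val = g.val ^ a := by simp
  by_cases hr : ∃ t : F, t * (g.val.trace - t) - 1 = 0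
  swap
  · -- nonsplit
    have hn : ¬ (g.val = 1 ∨ g.val = -1) := by
      rintro (h | h)
      · exact hr ⟨1, by rw [h]; simp; norm_num⟩
      · exact hr ⟨-1, by rw [h]; simp; norm_num⟩
    rw [hnonsplit]
    · rw [Finset.sum_eq_zero]
      · simp [hn]
      · intro t _
        exact if_neg fun h => hr ⟨t, h⟩
    · rintro ⟨x, hx⟩
      rw [hval] at hx
      refine hr (nonsplit_pow g a hq4 hqa (((g.val ^ a).trace + x) / 2) ?_)
      field_simp
      linear_combination -hx
  obtain ⟨t, ht⟩ := hr
  obtain ⟨s, hs⟩ : ∃ s, s = g.val.trace - t := ⟨_, rfl⟩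
  have hts : t * s = 1 := by rw [hs]; linear_combination ht
  have htr : g.val.trace = t + s := by rw [hs]; ring
  have hroot : ∀ x : F, x * (g.val.trace - x) - 1 = 0 ↔ x = t ∨ x = s := by
    intro x
    rw [← sub_eq_zero (a := x) (b := t), ← sub_eq_zero (a := x) (b := s), ← mul_eq_zero, htr]
    constructor
    · intro h; linear_combination -h + hts
    · intro h; linear_combination -h + hts
  have ht0 : t ≠ 0 := left_ne_zero_of_mul_eq_one hts
  simp only [hroot]
  have htra := trace_pow (K := F) g t s hts (by simpa using htr) a
  simp only [Algebra.algebraMap_self, RingHom.id_apply] at htra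
  obtain ⟨k, hk⟩ := haodd
  by_cases hst : t = s
  · -- t = ±1
    subst hst
    have htt : t ^ 2 = 1 := by rw [sq, hts]
    have hta : t ^ a = t := by rw [hk, pow_succ, pow_mul, htt, one_pow, one_mul]
    have hw : wt a t = 1 := by simp [wt, htt]
    have hpm : t = 1 ∨ t = -1 := pm_one htt
    simp only [or_self, Finset.sum_ite_eq', Finset.mem_univ, if_true, hw, sub_self, zero_add]
    have hform := pow_formula' g t hts htr (2 * k)
    have htk : t ^ (2*k) = 1 := by rw [pow_mul, htt, one_pow]
    rw [← hk, htk, one_smul] at hform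
    have hka : ((2 * k : ℕ) : F) + 1 = a := by rw [hk]; push_cast; ring
    rw [hka] at hform
    -- g^a = a g - (a-1) t ; g^a = c → g = t
    have hgt : ∀ c : F, g.val ^ a = c • 1 → g.val = t • 1 := by
      intro c h
      rw [h] at hform
      have e1 : (a : F) • g.val = (c + ((2 * k : ℕ) : F) * t) • 1 := by
        rw [add_smul, hform]; abel
      have e2 : g.val = ((a : F)⁻¹ * (c + ((2 * k : ℕ) : F) * t)) • 1 := by
        rw [mul_smul, ← e1, smul_smul, inv_mul_cancel₀ ha0, one_smul]
      generalize (a : F)⁻¹ * (c + ((2 * k : ℕ) : F) * t) = d at e2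
      have e3 := htr
      rw [e2] at e3
      simp at e3
      have e4 : d = t := mul_right_cancel₀ h2 (by linear_combination e3)
      rw [e2, e4]
    by_cases hc : g.val = 1 ∨ g.val = -1
    · rw [if_pos hc, hcentral]
      · simp
      · rw [hval]
        rcases hc with h | h
        · left; rw [h, one_pow]
        · right; rw [h]; exact Odd.neg_one_pow ⟨k, hk⟩
    · rw [if_neg hc, mul_zero]
      have hg' : ∀ c : F, g.val ^ a ≠ c • 1 := by
        intro c h
        apply hc
        rw [hgt c h]
        rcases hpm with h | h <;> simp [h]
      apply hunipotent
      · rw [hval]; simpa using hg' 1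
      · rw [hval]; simpa using hg' (-1)
      · rw [hval, htra, hta]
        rcases hpm with h | h
        · left; rw [h]; norm_num
        · right; rw [h]; norm_num
  · -- split
    have hc : ¬ (g.val = 1 ∨ g.val = -1) := by
      rintro (h | h)
      · have := htr
        rw [h] at this; simp at this
        have e : (t - s)^2 = 0 := by linear_combination (-(t+s) - 2) * this - 4 * hts
        exact hst (sub_eq_zero.mp (pow_eq_zero_iff (two_ne_zero) |>.mp e))
      · have := htr
        rw [h] at this; simp at this
        have e : (t - s)^2 = 0 := by linear_combination (-(t+s) + 2) * this - 4 * hts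
        exact hst (sub_eq_zero.mp (pow_eq_zero_iff (two_ne_zero) |>.mp e))
    rw [if_neg hc]
    have hsum : (∑ x : F, if x = t ∨ x = s then wt a x else 0) = wt a t + wt a s := by
      rw [← Finset.sum_filter]
      have : (Finset.univ.filter fun x : F => x = t ∨ x = s) = {t, s} := by ext; simp
      rw [this, Finset.sum_pair hst]
    rw [hsum]
    have hst2 : t ^ 2 ≠ 1 := by
      intro h; apply hst
      apply mul_left_cancel₀ ht0; rw [hts, ← sq, h]
    have hs_inv : s = t⁻¹ := eq_inv_of_mul_eq_one_right hts
    have hws : wt a s = wt a t := by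
      unfold wt; rw [hs_inv]; simp only [inv_pow, ne_eq, inv_eq_one]
    have htsa : t^a * s^a = 1 := by rw [← mul_pow, hts, one_pow]
    rw [hws]
    by_cases hta : t ^ (2 * a) = 1
    · have hw : wt a t = 1 + ((Fintype.card F : ℂ) - 1) / 2 := by
        simp [wt, hst2, hta]
      rw [hw, hcentral]
      · ring
      · rw [hval]
        have h1 : (t^a)^2 = 1 := by rw [← pow_mul, mul_comm, hta]
        have hta0 : t^a ≠ 0 := pow_ne_zero _ ht0
        have h2' : s^a = t^a := by
          apply mul_left_cancel₀ hta0; rw [htsa, ← sq, h1]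
        have hf := pow_formula g t s hts htr a
        rw [h2', ← smul_sub] at hf
        have h3 : (g.val - s • 1) - (g.val - t • 1) = (t - s) • (1 : Matrix (Fin 2) (Fin 2) F) := by
          rw [sub_smul]; abel
        rw [h3, smul_comm] at hf
        have h4 := smul_right_injective (Matrix (Fin 2) (Fin 2) F) (sub_ne_zero.mpr hst) hf
        rcases pm_one h1 with h | h
        · left; rw [h4, h]; simp
        · right; rw [h4, h]; simp
    · have hw : wt a t = 1 := by
        simp [wt, hta]
      have hd : t^a - s^a ≠ 0 := by
        intro h
        apply hta
        rw [mul_comm, pow_mul, sq]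
        nth_rw 2 [sub_eq_zero.mp h]
        exact htsa
      rw [hw, hsplit]
      · ring
      · rw [hval, htra]; intro h
        apply hd
        have e : (t^a - s^a)^2 = 0 := by linear_combination ((t^a+s^a) + 2) * h - 4 * htsa
        exact pow_eq_zero_iff (two_ne_zero) |>.mp e
      · rw [hval, htra]; intro h
        apply hd
        have e : (t^a - s^a)^2 = 0 := by linear_combination ((t^a+s^a) - 2) * h - 4 * htsa
        exact pow_eq_zero_iff (two_ne_zero) |>.mp e
      · refine ⟨t^a - s^a, hd, ?_⟩
        rw [hval, htra]
        linear_combination -4 * htsa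

lemma count_trace (t : F) (ht : t ≠ 0) :
    (∑ x : F, if x * (t + t⁻¹ - x) - 1 = 0 then (1 : ℂ) else 0) = 1 + if t ^ 2 ≠ 1 then 1 else 0 := by
  have hti : t * t⁻¹ = 1 := mul_inv_cancel₀ ht
  have hroot : ∀ x : F, x * (t + t⁻¹ - x) - 1 = 0 ↔ x = t ∨ x = t⁻¹ := by
    intro x
    rw [← sub_eq_zero (a := x) (b := t), ← sub_eq_zero (a := x) (b := t⁻¹), ← mul_eq_zero]
    constructor
    · intro h; linear_combination -h + hti
    · intro h; linear_combination -h + hti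
  simp only [hroot]
  rw [← Finset.sum_filter]
  have : (Finset.univ.filter fun x : F => x = t ∨ x = t⁻¹) = {t, t⁻¹} := by ext; simp
  rw [this]
  by_cases h : t ^ 2 = 1
  · have : t⁻¹ = t := by
      apply mul_left_cancel₀ ht; rw [hti, ← sq, h]
    simp [h, this]
  · have : t ≠ t⁻¹ := by
      intro e; apply h; rw [sq]; nth_rw 2 [e]; exact hti
    rw [Finset.sum_pair this]; simp [h]

lemma sum_wt (a : ℕ) (ha : 0 < a) (hd : 2 * a ∣ Fintype.card F - 1) (hd2 : 2 ∣ Fintype.card F - 1) :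
    (∑ g : SpecialLinearGroup (Fin 2) F, ∑ t : F, if t * (g.val.trace - t) - 1 = 0 then wt a t else 0)
    = (Fintype.card F : ℂ) ^ 2 * ((Fintype.card F : ℂ) - 1) + (Fintype.card F : ℂ) * ((Fintype.card F : ℂ) - 3)
      + ((Fintype.card F : ℂ) - 1) / 2 * ((Fintype.card F : ℂ)^2 + (Fintype.card F : ℂ)) * (2 * a - 2) := by
  rw [sum_sl (fun τ => ∑ t : F, if t * (τ - t) - 1 = 0 then wt a t else 0)]
  simp only [Finset.sum_mul]
  rw [Finset.sum_comm]
  set Q := (Fintype.card F : ℂ) with hQ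
  have step : ∀ t : F, (∑ τ : F, (if t * (τ - t) - 1 = 0 then wt a t else 0) *
      (Q * (Q - 1) + Q * ∑ x : F, if x * (τ - x) - 1 = 0 then 1 else 0))
      = Q ^ 2 * (if t ≠ 0 then 1 else 0) + Q * ((if t ≠ 0 then 1 else 0) - (if t ^ 2 = 1 then 1 else 0))
        + (Q - 1) / 2 * (Q ^ 2 + Q) * ((if t ^ (2 * a) = 1 then 1 else 0) - (if t ^ 2 = 1 then 1 else 0)) := by
    intro t
    by_cases ht : t = 0
    · subst ht; simp [ha.ne']
    · have h : ∀ τ : F, t * (τ - t) - 1 = 0 ↔ τ = t + t⁻¹ := by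
        intro τ
        constructor
        · intro h; field_simp; linear_combination h
        · rintro rfl; field_simp; ring
      simp only [h, ite_mul, zero_mul, Finset.sum_ite_eq', Finset.mem_univ, if_true]
      rw [count_trace t ht]
      unfold wt
      by_cases h2 : t ^ 2 = 1
      · have : t ^ (2 * a) = 1 := by rw [pow_mul, h2, one_pow]
        simp [h2, this, ht]; ring
      · by_cases h3 : t ^ (2 * a) = 1
        · simp [h2, h3, ht, ← hQ]; ring
        · simp [h2, h3, ht]; ring
  simp only [step]
  have c1 : (∑ t : F, if t ^ 2 = 1 then (1 : ℂ) else 0) = 2 := by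
    rw [Finset.sum_boole, card_roots_unity 2 (by norm_num) hd2]; norm_num
  have c2 : (∑ t : F, if t ^ (2 * a) = 1 then (1 : ℂ) else 0) = 2 * a := by
    rw [Finset.sum_boole, card_roots_unity (2 * a) (by omega) hd]; push_cast; ring
  have c3 : (∑ t : F, if t ≠ 0 then (1 : ℂ) else 0) = Q - 1 := by
    rw [Finset.sum_boole, Finset.filter_ne' Finset.univ (0 : F)]
    simp [Finset.card_erase_of_mem, Nat.cast_sub Fintype.card_pos, hQ]
  simp only [Finset.sum_add_distrib, ← Finset.mul_sum, Finset.sum_sub_distrib, c1, c2, c3]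
  ring

lemma sum_central (h2 : (2 : F) ≠ 0) :
    (∑ g : SpecialLinearGroup (Fin 2) F, if g.val = 1 ∨ g.val = -1 then (1 : ℂ) else 0) = 2 := by
  rw [Finset.sum_boole]
  have : (Finset.univ.filter fun g : SpecialLinearGroup (Fin 2) F => g.val = 1 ∨ g.val = -1) = {1, -1} := by
    ext g
    simp only [Finset.mem_filter, Finset.mem_univ, true_and, Finset.mem_insert, Finset.mem_singleton]
    refine or_congr ⟨fun h => Subtype.ext h, fun h => by rw [h]; rfl⟩
      ⟨fun h => Subtype.ext (h.trans ?_), fun h => by rw [h]; simp⟩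
    simp
  rw [this, Finset.card_pair]
  · norm_num
  · intro h
    have h1 := congrArg (fun g : SpecialLinearGroup (Fin 2) F => g.val 0 0) h
    simp at h1
    apply h2
    linear_combination h1

end helpers

/-- Let `q ≡ 1 (mod 4)` be a prime power and `a` an odd positive integer with
`q ≡ 1 (mod a)`.  Let `St` be the Steinberg character of `SL₂(𝔽_q)`: the irreducible
character of degree `q` taking value `q` on the central elements `±1`, value `0` on the
non-central elements of trace `±2` (the unipotent-type classes), value `1` on the split
semisimple classes (trace `t ≠ ±2` with `t² − 4` a nonzero square, i.e. conjugates of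
`diag(t, t⁻¹)`, `t ≠ ±1`), and value `−1` on the non-split semisimple classes (trace `t` with
`t² − 4` a non-square, i.e. classes of `diag(x, x^q)`, `x ≠ x^q`).  Then the `a`-th
Frobenius–Schur indicator `ν_a(St) = (1/|SL₂(𝔽_q)|) Σ_g St(g^a)` equals `a − 1`. -/
theorem stmt19 (F : Type) [Field F] [Fintype F] [DecidableEq F] (q : ℕ)
    (hq : Fintype.card F = q) (hq4 : q ≡ 1 [MOD 4])
    (a : ℕ) (ha : 0 < a) (haodd : Odd a) (hqa : q ≡ 1 [MOD a])
    (St : Matrix.SpecialLinearGroup (Fin 2) F → ℂ)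
    (hcentral : ∀ g : Matrix.SpecialLinearGroup (Fin 2) F,
      g.val = 1 ∨ g.val = -1 → St g = q)
    (hunipotent : ∀ g : Matrix.SpecialLinearGroup (Fin 2) F,
      g.val ≠ 1 → g.val ≠ -1 → (g.val.trace = 2 ∨ g.val.trace = -2) → St g = 0)
    (hsplit : ∀ g : Matrix.SpecialLinearGroup (Fin 2) F,
      g.val.trace ≠ 2 → g.val.trace ≠ -2 →
      (∃ x : F, x ≠ 0 ∧ x ^ 2 = g.val.trace ^ 2 - 4) → St g = 1)
    (hnonsplit : ∀ g : Matrix.SpecialLinearGroup (Fin 2) F,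
      (¬ ∃ x : F, x ^ 2 = g.val.trace ^ 2 - 4) → St g = -1) :
    (1 / (Fintype.card (Matrix.SpecialLinearGroup (Fin 2) F) : ℂ)) *
        ∑ g : Matrix.SpecialLinearGroup (Fin 2) F, St (g ^ a) = (a : ℂ) - 1 := by
  subst hq
  have hq1 : 1 < Fintype.card F := Fintype.one_lt_card
  have ha1 : a ∣ Fintype.card F - 1 := (Nat.modEq_iff_dvd' hq1.le).mp hqa.symm
  have h41 : 4 ∣ Fintype.card F - 1 := (Nat.modEq_iff_dvd' hq1.le).mp hq4.symm
  have hd2 : 2 ∣ Fintype.card F - 1 := Dvd.dvd.trans (by norm_num) h41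
  have hd : 2 * a ∣ Fintype.card F - 1 :=
    Nat.Coprime.mul_dvd_of_dvd_of_dvd (Nat.coprime_two_left.mpr haodd) hd2 ha1
  have hunit : ∀ n : ℕ, n ∣ Fintype.card F - 1 → (n : F) ≠ 0 := by
    rintro n ⟨k, hk⟩ hn
    have h1 : Fintype.card F = n * k + 1 := by omega
    have h2 : ((Fintype.card F : ℕ) : F) = 0 := FiniteField.cast_card_eq_zero F
    rw [h1] at h2
    push_cast at h2
    rw [hn] at h2
    simp at h2
  have h2 : (2 : F) ≠ 0 := by simpa using hunit 2 hd2
  have ha0 := hunit a ha1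
  simp only [pointwise a haodd hq4 hqa St hcentral hunipotent hsplit hnonsplit h2 ha0]
  rw [Finset.sum_add_distrib, Finset.sum_sub_distrib, ← Finset.mul_sum, sum_central h2, sum_wt a ha hd hd2]
  simp only [Finset.sum_const, Finset.card_univ, nsmul_eq_mul, mul_one]
  have hne : (Fintype.card (Matrix.SpecialLinearGroup (Fin 2) F) : ℂ) ≠ 0 := by
    exact_mod_cast Fintype.card_ne_zero
  rw [one_div, inv_mul_eq_iff_eq_mul₀ hne, card_sl]
  ring
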